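/- Let γ_b > 0 > γ_s, r = γ_b/(γ_b − γ_s), C_n > 0 a sequence of positive reals, and let R̃ : [0,∞)² → [0,∞) satisfy R̃(b,s) > 0 for (b,s) ≠ (0,0) and R̃(tb,ts) = t·R̃(b,s) for t ≥ 0, with t ↦ t^{r−1} R̃(t,1) having a unique positive minimizer. Suppose two sequences of functions R_n^{(1)}, R_n^{(2)} : (0,∞) → [0,∞) (corresponding to two kernels k₁, k₂) each satisfy the hypotheses of the minimax performance theorem with the same γ_b, γ_s, C_n and R̃ but with constants (S₁, B₁) and (S₂, B₂) respectively (S_j, B_j > 0). Then lim_{n→∞} [inf_{h>0} R_n^{(1)}(h)] / [inf_{h>0} R_n^{(2)}(h)] = S₁^r B₁^{1−r} / (S₂^r B₂^{1−r}); in particular the asymptotic relative efficiency of the two kernels depends on the rate exponent r but not on the performance criterion R̃. -/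

import Mathlib

open Filter Topology

/-- The rescaled bandwidth `h_n · (n C_n²)^{1/(2(γ_b−γ_s))}`. -/
noncomputable def scaledBW (γb γs : ℝ) (C : ℕ → ℝ) (h : ℕ → ℝ) (n : ℕ) : ℝ :=
  h n * ((n : ℝ) * (C n) ^ 2) ^ (1 / (2 * (γb - γs)))

/-- A bandwidth sequence is *regular* if `0 < liminf h_n·(nC_n²)^{1/(2(γ_b−γ_s))}` and
`limsup h_n·(nC_n²)^{1/(2(γ_b−γ_s))} < ∞`, phrased via eventual two-sided bounds. -/
def RegularBW (γb γs : ℝ) (C : ℕ → ℝ) (h : ℕ → ℝ) : Prop :=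
  ∃ c₁ c₂ : ℝ, 0 < c₁ ∧
    ∀ᶠ n in atTop, c₁ ≤ scaledBW γb γs C h n ∧ scaledBW γb γs C h n ≤ c₂

/-- The hypotheses of the minimax performance theorem (Theorem 2.1 of the paper) for a
sequence of worst-case performance functions `R n : (0,∞) → [0,∞)` with criterion `R'`,
rate constants `γb, γs, r`, smoothness constants `C n`, and kernel constants `S, B`:
(a) `R n (h n)/R̃(h_n^{γb} C_n B, h_n^{γs} n^{−1/2} S) → 1` along regular bandwidth
sequences; (b) `C_n^{r−1} n^{r/2} R_n(h_n) → ∞` along bandwidth sequences with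
`h_n (nC_n²)^{1/(2(γb−γs))} → ∞` or `→ 0`. -/
def MinimaxHyp (γb γs r : ℝ) (C : ℕ → ℝ) (R' : ℝ → ℝ → ℝ) (S B : ℝ)
    (R : ℕ → ℝ → ℝ) : Prop :=
  (∀ n : ℕ, ∀ h : ℝ, 0 < h → 0 ≤ R n h) ∧
  (∀ h : ℕ → ℝ, (∀ n, 0 < h n) → RegularBW γb γs C h →
    Tendsto (fun n : ℕ => R n (h n) /
      R' ((h n) ^ γb * C n * B) ((h n) ^ γs * (n : ℝ) ^ (-(1 : ℝ) / 2) * S))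
      atTop (𝓝 1)) ∧
  (∀ h : ℕ → ℝ, (∀ n, 0 < h n) →
    (Tendsto (scaledBW γb γs C h) atTop atTop ∨
      Tendsto (scaledBW γb γs C h) atTop (𝓝 0)) →
    Tendsto (fun n : ℕ => (C n) ^ (r - 1) * (n : ℝ) ^ (r / 2) * R n (h n)) atTop atTop)

/-- If `Q n` is asymptotically bounded below by `m` along sequences bounded away from `0` and `∞`,
blows up along sequences tending to `0` or `∞`, and converges to `m` at one point, then its
infimum over `(0, ∞)` converges to `m`. -/
lemma tendsto_sInf_image_Ioi {Q : ℕ → ℝ → ℝ} {m x₀ : ℝ} (hx₀ : 0 < x₀)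
    (hQ : ∀ n x, 0 < x → 0 ≤ Q n x)
    (hup : Tendsto (fun n => Q n x₀) atTop (𝓝 m))
    (hlow : ∀ x : ℕ → ℝ, (∀ n, 0 < x n) → ∀ c₁ c₂ : ℝ, 0 < c₁ →
      (∀ n, c₁ ≤ x n ∧ x n ≤ c₂) → ∀ c < m, ∀ᶠ n in atTop, c ≤ Q n (x n))
    (htop : ∀ x : ℕ → ℝ, (∀ n, 0 < x n) → Tendsto x atTop atTop →
      Tendsto (fun n => Q n (x n)) atTop atTop)
    (hzero : ∀ x : ℕ → ℝ, (∀ n, 0 < x n) → Tendsto x atTop (𝓝 0) →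
      Tendsto (fun n => Q n (x n)) atTop atTop) :
    Tendsto (fun n => sInf (Q n '' Set.Ioi 0)) atTop (𝓝 m) := by
  have hbdd : ∀ n, BddBelow (Q n '' Set.Ioi 0) := fun n =>
    ⟨0, by rintro _ ⟨x, hx, rfl⟩; exact hQ n x hx⟩
  -- the lower bound holds along every positive sequence
  have key : ∀ x : ℕ → ℝ, (∀ n, 0 < x n) → ∀ c < m, ∀ᶠ n in atTop, c ≤ Q n (x n) := by
    intro x hx c hc
    have hmid : ∀ K : ℝ, 0 < K → ∀ L : ℝ, ∀ᶠ n in atTop,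
        Q n (x n) < c → K ≤ x n → x n ≤ L → False := by
      intro K hK L
      classical
      have := hlow (fun n => if K ≤ x n ∧ x n ≤ L then x n else x₀)
        (fun n => by split_ifs; exacts [hx n, hx₀]) (min K x₀) (max L x₀)
        (lt_min hK hx₀)
        (fun n => by
          split_ifs with h
          · exact ⟨(min_le_left _ _).trans h.1, h.2.trans (le_max_left _ _)⟩
          · exact ⟨min_le_right _ _, le_max_right _ _⟩) c hc
      filter_upwards [this] with n hn h1 h2 h3
      rw [if_pos ⟨h2, h3⟩] at hn
      exact absurd hn (not_le.mpr h1)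
    classical
    have hbig : ∀ᶠ n in atTop, ¬ (Q n (x n) < c ∧ 1 ≤ x n) := by
      have ht := htop (fun n => if Q n (x n) < c ∧ 1 ≤ x n then x n else (n : ℝ) + 1)
        (fun n => by split_ifs; exacts [hx n, by positivity])
        (by
          rw [tendsto_atTop]
          intro L
          filter_upwards [hmid 1 one_pos L, tendsto_natCast_atTop_atTop.eventually_ge_atTop L]
            with n h1 h2
          split_ifs with h
          · by_contra! hlt
            exact h1 h.1 h.2 hlt.le
          · linarith)
      filter_upwards [ht.eventually_ge_atTop c] with n hn h
      rw [if_pos h] at hn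
      exact absurd hn (not_le.mpr h.1)
    have hsmall : ∀ᶠ n in atTop, ¬ (Q n (x n) < c ∧ x n ≤ 1) := by
      have ht := hzero (fun n => if Q n (x n) < c ∧ x n ≤ 1 then x n else 1 / ((n : ℝ) + 1))
        (fun n => by split_ifs; exacts [hx n, by positivity])
        (by
          rw [Metric.tendsto_nhds]
          intro ε hε
          filter_upwards [hmid ε hε 1,
            tendsto_one_div_add_atTop_nhds_zero_nat.eventually_lt_const hε] with n h1 h2
          rw [Real.dist_eq, sub_zero]
          split_ifs with h
          · rw [abs_of_pos (hx n)]
            by_contra! hlt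
            exact h1 h.1 hlt h.2
          · rwa [abs_of_pos (by positivity)])
      filter_upwards [ht.eventually_ge_atTop c] with n hn h
      rw [if_pos h] at hn
      exact absurd hn (not_le.mpr h.1)
    filter_upwards [hbig, hsmall] with n h1 h2
    by_contra! h
    rcases le_total 1 (x n) with h3 | h3
    · exact h1 ⟨h, h3⟩
    · exact h2 ⟨h, h3⟩
  rw [tendsto_order]
  constructor
  · intro c hc
    have hex : ∀ n, ∃ x : ℝ, 0 < x ∧ Q n x < sInf (Q n '' Set.Ioi 0) + (m - c) / 2 := by
      intro n
      obtain ⟨_, ⟨x, hx, rfl⟩, h⟩ := Real.lt_sInf_add_pos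
        (s := Q n '' Set.Ioi 0) ⟨_, x₀, hx₀, rfl⟩ (ε := (m - c) / 2) (by linarith)
      exact ⟨x, hx, h⟩
    choose x hx hxQ using hex
    filter_upwards [key x hx ((m + c) / 2) (by linarith)] with n hn
    linarith [hxQ n]
  · intro c hc
    filter_upwards [hup.eventually_lt_const hc] with n hn
    exact (csInf_le (hbdd n) ⟨x₀, hx₀, rfl⟩).trans_lt hn

/-- Along the bandwidth `x · (N c²)^{-1/(2(γb−γs))}`, the normalized criterion is an explicit
multiple of `t ^ (r - 1) * R' t 1` with `t = x ^ (γb - γs) * B / S`. -/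
lemma normalized_criterion_eq {γb γs r : ℝ} (hγ : 0 < γb - γs) (hr : r = γb / (γb - γs))
    {R' : ℝ → ℝ → ℝ}
    (hom : ∀ t b s : ℝ, 0 ≤ t → 0 ≤ b → 0 ≤ s → R' (t * b) (t * s) = t * R' b s)
    {c N x S B : ℝ} (hc : 0 < c) (hN : 0 < N) (hx : 0 < x) (hS : 0 < S) (hB : 0 < B) :
    c ^ (r - 1) * N ^ (r / 2) *
      R' ((x / (N * c ^ 2) ^ (1 / (2 * (γb - γs)))) ^ γb * c * B)
        ((x / (N * c ^ 2) ^ (1 / (2 * (γb - γs)))) ^ γs * N ^ (-(1 : ℝ) / 2) * S) =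
    S ^ r * B ^ (1 - r) *
      ((x ^ (γb - γs) * B / S) ^ (r - 1) * R' (x ^ (γb - γs) * B / S) 1) := by
  have hne : γb - γs ≠ 0 := hγ.ne'
  set t := x ^ (γb - γs) * B / S with ht
  set s := (x / (N * c ^ 2) ^ (1 / (2 * (γb - γs)))) ^ γs * N ^ (-(1 : ℝ) / 2) * S with hs
  have ht0 : 0 < t := by positivity
  have hs0 : 0 < s := by positivity
  have hb : (x / (N * c ^ 2) ^ (1 / (2 * (γb - γs)))) ^ γb * c * B = s * t := by
    rw [hs, ht]
    obtain ⟨c, rfl⟩ : ∃ y, Real.exp y = c := ⟨_, Real.exp_log hc⟩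
    obtain ⟨N, rfl⟩ : ∃ y, Real.exp y = N := ⟨_, Real.exp_log hN⟩
    obtain ⟨x, rfl⟩ : ∃ y, Real.exp y = x := ⟨_, Real.exp_log hx⟩
    obtain ⟨S, rfl⟩ : ∃ y, Real.exp y = S := ⟨_, Real.exp_log hS⟩
    obtain ⟨B, rfl⟩ : ∃ y, Real.exp y = B := ⟨_, Real.exp_log hB⟩
    simp only [← Real.rpow_natCast, ← Real.exp_mul, ← Real.exp_add, ← Real.exp_sub]
    congr 1
    field_simp
    push_cast
    ring
  have ha : c ^ (r - 1) * N ^ (r / 2) * s = S ^ r * B ^ (1 - r) * t ^ (r - 1) := by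
    rw [hs, ht, hr]
    obtain ⟨c, rfl⟩ : ∃ y, Real.exp y = c := ⟨_, Real.exp_log hc⟩
    obtain ⟨N, rfl⟩ : ∃ y, Real.exp y = N := ⟨_, Real.exp_log hN⟩
    obtain ⟨x, rfl⟩ : ∃ y, Real.exp y = x := ⟨_, Real.exp_log hx⟩
    obtain ⟨S, rfl⟩ : ∃ y, Real.exp y = S := ⟨_, Real.exp_log hS⟩
    obtain ⟨B, rfl⟩ : ∃ y, Real.exp y = B := ⟨_, Real.exp_log hB⟩
    simp only [← Real.rpow_natCast, ← Real.exp_mul, ← Real.exp_add, ← Real.exp_sub]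
    congr 1
    field_simp
    push_cast
    ring
  have hR : R' (s * t) s = s * R' t 1 := by
    simpa using hom s t 1 hs0.le ht0.le zero_le_one
  rw [hb, hR, ← mul_assoc, ha]
  ring

/-- The normalized minimax risk `C_n^{r−1} n^{r/2} inf_h R_n(h)` converges to
`S^r B^{1−r} min_t t^{r−1} R̃(t,1)`. -/
lemma MinimaxHyp.tendsto_normalized_sInf {γb γs r : ℝ} (hγ : 0 < γb - γs)
    (hr : r = γb / (γb - γs)) {C : ℕ → ℝ} (hC : ∀ n, 0 < C n) {R' : ℝ → ℝ → ℝ}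
    (hom : ∀ t b s : ℝ, 0 ≤ t → 0 ≤ b → 0 ≤ s → R' (t * b) (t * s) = t * R' b s)
    {tstar : ℝ} (htstar : 0 < tstar) (hpos : 0 < R' tstar 1)
    (hmin : ∀ t : ℝ, 0 < t → tstar ^ (r - 1) * R' tstar 1 ≤ t ^ (r - 1) * R' t 1)
    {S B : ℝ} (hS : 0 < S) (hB : 0 < B) {R : ℕ → ℝ → ℝ} (h : MinimaxHyp γb γs r C R' S B R) :
    Tendsto (fun n : ℕ => (C n) ^ (r - 1) * (n : ℝ) ^ (r / 2) * sInf (R n '' Set.Ioi 0)) atTop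
      (𝓝 (S ^ r * B ^ (1 - r) * (tstar ^ (r - 1) * R' tstar 1))) := by
  obtain ⟨hnonneg, hreg, hext⟩ := h
  -- the bandwidth scale, with its degenerate value at `n = 0` made positive
  let u : ℕ → ℝ := fun n =>
    if n = 0 then 1 else ((n : ℝ) * (C n) ^ 2) ^ (1 / (2 * (γb - γs)))
  have hu : ∀ n, 0 < u n := by
    intro n
    have := hC n
    by_cases hn : n = 0
    · simp [u, hn]
    · have : (0 : ℝ) < n := by positivity
      simp only [u, hn, if_false]
      positivity
  have hueq : ∀ n : ℕ, n ≠ 0 → u n = ((n : ℝ) * (C n) ^ 2) ^ (1 / (2 * (γb - γs))) :=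
    fun n hn => if_neg hn
  have hscaled : ∀ x : ℕ → ℝ, scaledBW γb γs C (fun n => x n / u n) =ᶠ[atTop] x := by
    intro x
    filter_upwards [eventually_ne_atTop 0] with n hn
    rw [scaledBW, ← hueq n hn, div_mul_cancel₀ _ (hu n).ne']
  let a : ℕ → ℝ := fun n => (C n) ^ (r - 1) * (n : ℝ) ^ (r / 2)
  have ha : ∀ n, 0 ≤ a n := fun n => by have := hC n; positivity
  have hapos : ∀ n : ℕ, n ≠ 0 → 0 < a n := fun n hn => by
    have := hC n
    have : (0 : ℝ) < n := by positivity
    positivity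
  let Q : ℕ → ℝ → ℝ := fun n x => a n * R n (x / u n)
  have hset : ∀ n, a n * sInf (R n '' Set.Ioi 0) = sInf (Q n '' Set.Ioi 0) := by
    intro n
    rw [← smul_eq_mul, ← Real.sInf_smul_of_nonneg (ha n)]
    congr 1
    ext y
    constructor
    · rintro ⟨_, ⟨z, hz, rfl⟩, rfl⟩
      refine ⟨z * u n, mul_pos hz (hu n), ?_⟩
      simp only [Q, mul_div_cancel_right₀ _ (hu n).ne', smul_eq_mul]
    · rintro ⟨z, hz, rfl⟩
      exact ⟨_, ⟨z / u n, div_pos hz (hu n), rfl⟩, rfl⟩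
  let G : ℝ → ℝ := fun x => S ^ r * B ^ (1 - r) *
      ((x ^ (γb - γs) * B / S) ^ (r - 1) * R' (x ^ (γb - γs) * B / S) 1)
  set m := S ^ r * B ^ (1 - r) * (tstar ^ (r - 1) * R' tstar 1) with hm
  have hm0 : 0 < m := by positivity
  have hGm : ∀ x, 0 < x → m ≤ G x := fun x hx =>
    mul_le_mul_of_nonneg_left (hmin _ (by positivity)) (by positivity)
  have hratio : ∀ x : ℕ → ℝ, (∀ n, 0 < x n) → ∀ c₁ c₂ : ℝ, 0 < c₁ →
      (∀ n, c₁ ≤ x n ∧ x n ≤ c₂) → Tendsto (fun n => Q n (x n) / G (x n)) atTop (𝓝 1) := by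
    intro x hx c₁ c₂ hc₁ hx12
    refine (hreg (fun n => x n / u n) (fun n => div_pos (hx n) (hu n)) ⟨c₁, c₂, hc₁, ?_⟩).congr' ?_
    · filter_upwards [hscaled x] with n hn
      rw [hn]
      exact hx12 n
    · filter_upwards [eventually_ne_atTop 0] with n hn
      have hn' : (0 : ℝ) < n := by positivity
      simp only [G, Q, ← normalized_criterion_eq hγ hr hom (hC n) hn' (hx n) hS hB, hueq n hn]
      exact (mul_div_mul_left _ _ (hapos n hn).ne').symm
  have hextQ : ∀ x : ℕ → ℝ, (∀ n, 0 < x n) → Tendsto x atTop atTop ∨ Tendsto x atTop (𝓝 0) →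
      Tendsto (fun n => Q n (x n)) atTop atTop := by
    intro x hx hlim
    exact hext (fun n => x n / u n) (fun n => div_pos (hx n) (hu n))
      (hlim.imp (fun h => h.congr' (hscaled x).symm) (fun h => h.congr' (hscaled x).symm))
  have hQ : ∀ n x, 0 < x → 0 ≤ Q n x := fun n x hx =>
    mul_nonneg (ha n) (hnonneg n _ (div_pos hx (hu n)))
  let x₀ : ℝ := (tstar * S / B) ^ (1 / (γb - γs))
  have hx₀ : 0 < x₀ := by positivity
  have hG₀ : G x₀ = m := by
    have : x₀ ^ (γb - γs) * B / S = tstar := by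
      simp only [x₀]
      rw [← Real.rpow_mul (by positivity), one_div_mul_cancel hγ.ne', Real.rpow_one]
      field_simp
    simp only [G, this, hm]
  refine Tendsto.congr (fun n => (hset n).symm) (tendsto_sInf_image_Ioi hx₀ hQ ?_ ?_
    (fun x hx h => hextQ x hx (Or.inl h)) (fun x hx h => hextQ x hx (Or.inr h)))
  · have := (hratio (fun _ => x₀) (fun _ => hx₀) x₀ x₀ hx₀ (fun _ => ⟨le_rfl, le_rfl⟩)).mul_const m
    rw [one_mul] at this
    refine this.congr fun n => ?_
    rw [hG₀, div_mul_cancel₀ _ hm0.ne']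
  · intro x hx c₁ c₂ hc₁ hx12 c hc
    rcases le_or_gt c 0 with hc0 | hc0
    · exact Eventually.of_forall fun n => hc0.trans (hQ n _ (hx n))
    have hlt : c / m < 1 := (div_lt_one hm0).mpr hc
    filter_upwards [(hratio x hx c₁ c₂ hc₁ hx12).eventually_const_lt hlt] with n hn
    have hGx := hGm _ (hx n)
    rw [lt_div_iff₀ (hm0.trans_le hGx)] at hn
    calc c = c / m * m := (div_mul_cancel₀ _ hm0.ne').symm
      _ ≤ c / m * G (x n) := by gcongr
      _ ≤ Q n (x n) := hn.le

/-- Theorem 2.1(ii) of the paper: asymptotic relative kernel efficiency.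
If two sequences of worst-case performance functions `R₁, R₂` (corresponding to two
kernels) satisfy the hypotheses of the minimax performance theorem with the same
`γb, γs, C_n` and criterion `R̃`, but with constants `(S₁,B₁)` and `(S₂,B₂)`, then the
ratio of the minimax risks converges to `S₁^r B₁^{1−r}/(S₂^r B₂^{1−r})`: the asymptotic
relative efficiency depends on the rate exponent `r` but not on the criterion `R̃`. -/
theorem stmt1 (γb γs r : ℝ) (hγb : 0 < γb) (hγs : γs < 0)
    (hr : r = γb / (γb - γs))
    (C : ℕ → ℝ) (hC : ∀ n, 0 < C n)
    (R' : ℝ → ℝ → ℝ)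
    (hR'nonneg : ∀ b s : ℝ, 0 ≤ b → 0 ≤ s → 0 ≤ R' b s)
    (hR'pos : ∀ b s : ℝ, 0 ≤ b → 0 ≤ s → ¬(b = 0 ∧ s = 0) → 0 < R' b s)
    (hR'hom : ∀ t b s : ℝ, 0 ≤ t → 0 ≤ b → 0 ≤ s → R' (t * b) (t * s) = t * R' b s)
    (tstar : ℝ) (htstar : 0 < tstar)
    (hmin : ∀ t : ℝ, 0 < t → t ≠ tstar →
      tstar ^ (r - 1) * R' tstar 1 < t ^ (r - 1) * R' t 1)
    (S₁ B₁ S₂ B₂ : ℝ) (hS₁ : 0 < S₁) (hB₁ : 0 < B₁) (hS₂ : 0 < S₂) (hB₂ : 0 < B₂)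
    (R₁ R₂ : ℕ → ℝ → ℝ)
    (h₁ : MinimaxHyp γb γs r C R' S₁ B₁ R₁)
    (h₂ : MinimaxHyp γb γs r C R' S₂ B₂ R₂) :
    Tendsto (fun n : ℕ =>
        sInf ((fun h : ℝ => R₁ n h) '' Set.Ioi (0 : ℝ)) /
          sInf ((fun h : ℝ => R₂ n h) '' Set.Ioi (0 : ℝ))) atTop
      (𝓝 (S₁ ^ r * B₁ ^ (1 - r) / (S₂ ^ r * B₂ ^ (1 - r)))) := by
  have hγ : 0 < γb - γs := by linarith
  have hpos : 0 < R' tstar 1 := hR'pos _ _ htstar.le zero_le_one (by simp)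
  have hmin' : ∀ t : ℝ, 0 < t → tstar ^ (r - 1) * R' tstar 1 ≤ t ^ (r - 1) * R' t 1 := by
    intro t ht
    rcases eq_or_ne t tstar with rfl | hne
    · exact le_rfl
    · exact (hmin t ht hne).le
  have l₁ := h₁.tendsto_normalized_sInf hγ hr hC hR'hom htstar hpos hmin' hS₁ hB₁
  have l₂ := h₂.tendsto_normalized_sInf hγ hr hC hR'hom htstar hpos hmin' hS₂ hB₂
  have hm : 0 < tstar ^ (r - 1) * R' tstar 1 := by positivity
  have l := l₁.div l₂ (by positivity)
  rw [mul_div_mul_right _ _ hm.ne'] at l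
  refine l.congr' ?_
  filter_upwards [eventually_ne_atTop 0] with n hn
  have hCn := hC n
  have hn' : (0 : ℝ) < n := by positivity
  have ha : 0 < (C n) ^ (r - 1) * (n : ℝ) ^ (r / 2) := by positivity
  exact mul_div_mul_left _ _ ha.ne'
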